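/- Multicolour container theorem: Let k ≥ 2 and N ∈ ℕ be fixed and let F be a nonempty collection of k-colourings of K_N. For every ε > 0 there exist constants C₀ > 0 and n₀ ∈ ℕ (depending only on ε, k, N) such that for every n ≥ n₀ there exists a collection T_n of k-colouring templates for K_n satisfying: (i) T_n is a container family for Forb(F)_n; (ii) for each template t ∈ T_n, the number of pairs (φ, c) with φ ∈ binom(K_n, K_N), c ∈ F and c ∈ ⟨t|φ⟩ is at most ε·C(n,N); and (iii) log_k |T_n| ≤ C₀ · n^{−1/(2·C(N,2)−1)} · C(n,2). -/

import Mathlib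

open Filter

abbrev Edge (n : ℕ) := {p : Fin n × Fin n // p.1 < p.2}

abbrev Colouring (k n : ℕ) := Edge n → Fin k

abbrev Template (k n : ℕ) := Edge n → Finset (Fin k)

def Proper {k n : ℕ} (t : Template k n) : Prop := ∀ e, (t e).Nonempty

def Realises {k n : ℕ} (c : Colouring k n) (t : Template k n) : Prop := ∀ e, c e ∈ t e

noncomputable def Ent {k n : ℕ} (t : Template k n) : ℝ :=
  ∑ e : Edge n, Real.logb k ((t e).card)

def Edge.map {m n : ℕ} (φ : Fin m → Fin n) (h : StrictMono φ) (e : Edge m) : Edge n :=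
  ⟨(φ e.1.1, φ e.1.2), h e.2⟩

def restrictC {k m n : ℕ} (c : Colouring k n) (φ : Fin m → Fin n) (h : StrictMono φ) :
    Colouring k m := fun e => c (Edge.map φ h e)

def restrictT {k m n : ℕ} (t : Template k n) (φ : Fin m → Fin n) (h : StrictMono φ) :
    Template k m := fun e => t (Edge.map φ h e)

def Forb {k N : ℕ} (F : Set (Colouring k N)) (n : ℕ) : Set (Colouring k n) :=
  {c | ∀ (φ : Fin N → Fin n) (h : StrictMono φ), restrictC c φ h ∉ F}

def OrderHereditary {k : ℕ} (P : ∀ n, Set (Colouring k n)) : Prop :=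
  ∀ (m n : ℕ) (φ : Fin m → Fin n) (h : StrictMono φ) (c : Colouring k n),
    c ∈ P n → restrictC c φ h ∈ P m

noncomputable def exEnt {k n : ℕ} (A : Set (Colouring k n)) : ℝ :=
  sSup {x | ∃ t : Template k n, Proper t ∧ (∀ c, Realises c t → c ∈ A) ∧ Ent t = x}

noncomputable def badPairs {k N n : ℕ} (t : Template k n) (F : Set (Colouring k N)) : ℕ :=
  Set.ncard {p : (Fin N → Fin n) × Colouring k N |
    ∃ h : StrictMono p.1, p.2 ∈ F ∧ Realises p.2 (restrictT t p.1 h)}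

def TemplateLE {k m n : ℕ} (t : Template k m) (t' : Template k n) : Prop :=
  ∃ (φ : Fin m → Fin n) (h : StrictMono φ), ∀ e, t e ⊆ restrictT t' φ h e

def IsContainerFamily {k n : ℕ} (T : Finset (Template k n)) (A : Set (Colouring k n)) : Prop :=
  ∀ t : Template k n, Proper t → (∀ c, Realises c t → c ∈ A) → ∃ t' ∈ T, TemplateLE t t'


theorem mc_double {V ι : Type} [Fintype V] [DecidableEq V]
    (E : Finset ι) (f : ι → Finset V) :
    ∑ u : V, (E.filter (fun i => u ∈ f i)).card = ∑ i ∈ E, (f i).card := by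
  classical
  simp_rw [Finset.card_filter]
  rw [Finset.sum_comm]
  refine Finset.sum_congr rfl fun i _ => ?_
  simp

/-- If all degrees are at most `D` and the total number of edges is at least `β D M / 2`, then
many vertices have degree at least `β D / 4`. -/
theorem mc_high {V ι : Type} [Fintype V] [DecidableEq V] (s : ℕ)
    (A : Finset ι) (f : ι → Finset V) (hA : ∀ i ∈ A, (f i).card = s + 1) (D β : ℝ) (hD : 0 < D)
    (hdeg : ∀ u, ((A.filter (fun i => u ∈ f i)).card : ℝ) ≤ D)
    (hsize : β * D * (Fintype.card V : ℝ) / 2 ≤ A.card) (hβ : 0 < β) :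
    β * (Fintype.card V : ℝ) / 4 ≤
      ((Finset.univ.filter (fun u => β * D / 4 ≤ ((A.filter (fun i => u ∈ f i)).card : ℝ))).card : ℝ) := by
  classical
  set H := Finset.univ.filter (fun u => β * D / 4 ≤ ((A.filter (fun i => u ∈ f i)).card : ℝ)) with hH
  have h1 : (A.card : ℝ) ≤ ∑ u : V, ((A.filter (fun i => u ∈ f i)).card : ℝ) := by
    have h := mc_double A f
    have h2 : A.card ≤ ∑ i ∈ A, (f i).card := by
      rw [Finset.card_eq_sum_ones]
      exact Finset.sum_le_sum fun i hi => by rw [hA i hi]; omega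
    rw [← h] at h2
    exact_mod_cast h2
  have h2 : ∑ u : V, ((A.filter (fun i => u ∈ f i)).card : ℝ) ≤
      ∑ u : V, ((if u ∈ H then D else 0) + β * D / 4) := by
    refine Finset.sum_le_sum fun u _ => ?_
    by_cases hu : u ∈ H
    · simp only [hu, if_true]
      have := hdeg u
      have : 0 < β * D := by positivity
      linarith [hdeg u]
    · simp only [hu, if_false]
      simp only [hH, Finset.mem_filter, Finset.mem_univ, true_and, not_le] at hu
      linarith
  rw [Finset.sum_add_distrib] at h2
  simp only [Finset.sum_ite_mem, Finset.univ_inter, Finset.sum_const, nsmul_eq_mul,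
    Finset.card_univ] at h2
  have h3 : β * (Fintype.card V : ℝ) / 4 * D ≤ H.card * D := by nlinarith
  exact le_of_mul_le_mul_right h3 hD

theorem mc_sizeA {V ι : Type} [Fintype V] [DecidableEq V] [DecidableEq ι] (s j q : ℕ)
    (E E' : Finset ι) (f f' : ι → Finset V) (D D' c β : ℝ) (hD : 0 < D) (hD' : 0 < D')
    (hβ : 0 < β) (hjq : j ≤ q)
    (hdeg : ∀ u, ((E.filter (fun i => u ∈ f i)).card : ℝ) ≤ D)
    (hsize : β * D * (Fintype.card V : ℝ) ≤ E.card)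
    (hc : c ≤ D' / 2) (hq : (q : ℝ) ≤ β * (Fintype.card V : ℝ) / 4)
    (hsat : 8 * (s : ℝ) * q * D ≤ β * (Fintype.card V : ℝ) * D')
    (hE' : ∀ i ∈ E', (f' i).card = s) (hup : (E'.card : ℝ) ≤ j * D) :
    β * D * (Fintype.card V : ℝ) / 2 ≤ ((E.filter (fun i => i ∉ E' ∧
      ∀ u ∈ f i, ((E'.filter (fun i => u ∈ f' i)).card : ℝ) + c ≤ D')).card : ℝ) := by
  classical
  set M : ℝ := (Fintype.card V : ℝ) with hM
  set A := E.filter (fun i => i ∉ E' ∧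
      ∀ u ∈ f i, ((E'.filter (fun i => u ∈ f' i)).card : ℝ) + c ≤ D') with hA
  set S := Finset.univ.filter (fun u : V => D' < ((E'.filter (fun i => u ∈ f' i)).card : ℝ) + c)
    with hS
  have hjq' : (j : ℝ) ≤ q := by exact_mod_cast hjq
  have h1 : E ⊆ A ∪ (E' ∪ S.biUnion (fun u => E.filter (fun i => u ∈ f i))) := by
    intro i hi
    by_cases h1 : i ∈ E'
    · simp [h1]
    by_cases h2 : ∀ u ∈ f i, ((E'.filter (fun i => u ∈ f' i)).card : ℝ) + c ≤ D'
    · refine Finset.mem_union_left _ ?_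
      rw [hA, Finset.mem_filter]
      exact ⟨hi, h1, h2⟩
    · push Not at h2
      obtain ⟨u, hu, hu2⟩ := h2
      refine Finset.mem_union_right _ (Finset.mem_union_right _ ?_)
      rw [Finset.mem_biUnion]
      exact ⟨u, by simp [hS, hu2], by simp [hi, hu]⟩
  have h2 : (E.card : ℝ) ≤ A.card + (E'.card + ((S.biUnion (fun u => E.filter (fun i => u ∈ f i))).card : ℝ)) := by
    have := Finset.card_le_card h1
    have h3 := Finset.card_union_le A (E' ∪ S.biUnion (fun u => E.filter (fun i => u ∈ f i)))
    have h4 := Finset.card_union_le E' (S.biUnion (fun u => E.filter (fun i => u ∈ f i)))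
    have : E.card ≤ A.card + (E'.card + (S.biUnion (fun u => E.filter (fun i => u ∈ f i))).card) := by
      omega
    exact_mod_cast this
  have h3 : ((S.biUnion (fun u => E.filter (fun i => u ∈ f i))).card : ℝ) ≤ S.card * D := by
    have : ((S.biUnion (fun u => E.filter (fun i => u ∈ f i))).card : ℝ) ≤
        ∑ u ∈ S, ((E.filter (fun i => u ∈ f i)).card : ℝ) := by
      exact_mod_cast Finset.card_biUnion_le
    refine this.trans ?_
    refine (Finset.sum_le_sum fun u _ => hdeg u).trans ?_
    simp
  have h4 : (S.card : ℝ) * (D' / 2) ≤ s * (q * D) := by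
    have h5 : ∑ u : V, ((E'.filter (fun i => u ∈ f' i)).card : ℝ) = s * E'.card := by
      have h := mc_double E' f'
      rw [Finset.sum_congr rfl hE'] at h
      simp only [Finset.sum_const, smul_eq_mul] at h
      rw [mul_comm]
      exact_mod_cast h
    have h6 : (S.card : ℝ) * (D' / 2) ≤ ∑ u ∈ S, ((E'.filter (fun i => u ∈ f' i)).card : ℝ) := by
      rw [← nsmul_eq_mul]
      refine Finset.card_nsmul_le_sum _ _ _ fun u hu => ?_
      simp only [hS, Finset.mem_filter, Finset.mem_univ, true_and] at hu
      linarith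
    have h7 : ∑ u ∈ S, ((E'.filter (fun i => u ∈ f' i)).card : ℝ) ≤
        ∑ u : V, ((E'.filter (fun i => u ∈ f' i)).card : ℝ) :=
      Finset.sum_le_sum_of_subset_of_nonneg (Finset.subset_univ _) (fun _ _ _ => by positivity)
    rw [h5] at h7
    refine h6.trans (h7.trans ?_)
    gcongr
    refine hup.trans ?_
    gcongr
  have h8 : (S.card : ℝ) * 4 ≤ β * M := by
    refine le_of_mul_le_mul_right ?_ hD'
    nlinarith
  have h9 : (j : ℝ) * D ≤ β * M / 4 * D := by
    gcongr; linarith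
  have h10 : (S.card : ℝ) * D ≤ β * M / 4 * D := by
    gcongr; linarith
  nlinarith

/-- One level of the container algorithm. -/
theorem mc_inner {V ι : Type} [Fintype V] [DecidableEq V] [DecidableEq ι] (s q B : ℕ)
    (hB : 1 ≤ B)
    (E : Finset ι) (f : ι → Finset V) (D D' c β δ : ℝ) (hD : 0 < D) (hD' : 0 < D')
    (hβ : 0 < β)
    (hE : ∀ i ∈ E, (f i).card = s + 1)
    (hdeg : ∀ u, ((E.filter (fun i => u ∈ f i)).card : ℝ) ≤ D)
    (hcod : ∀ u w, u ≠ w → ((E.filter (fun i => u ∈ f i ∧ w ∈ f i)).card : ℝ) ≤ c)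
    (hsize : β * D * (Fintype.card V : ℝ) ≤ E.card)
    (hc : c ≤ D' / 2) (hq : (q : ℝ) ≤ β * (Fintype.card V : ℝ) / 4)
    (hsat : 8 * (s : ℝ) * q * D ≤ β * (Fintype.card V : ℝ) * D')
    (hδ : δ ≤ β / 4)
    (hIH : ∀ (E' : Finset ι) (f' : ι → Finset V), E' ⊆ E → (∀ i ∈ E', f' i ⊆ f i) →
      (∀ i ∈ E', (f' i).card = s) →
      (∀ u, ((E'.filter (fun i => u ∈ f' i)).card : ℝ) ≤ D') → q * (β * D / 4) ≤ E'.card →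
      ∃ 𝒞 : Finset (Finset V), 𝒞.card ≤ B ∧
        (∀ R ∈ 𝒞, δ * (Fintype.card V : ℝ) ≤ R.card ∧ ∀ u ∈ R, ∃ i ∈ E, u ∈ f i) ∧
        ∀ I : Finset V, (∀ i ∈ E', ¬ f' i ⊆ I) → ∃ R ∈ 𝒞, Disjoint R I) :
    ∀ (r j : ℕ), j + r = q → ∀ (E' : Finset ι) (f' : ι → Finset V), E' ⊆ E →
      (∀ i ∈ E', f' i ⊆ f i) → (∀ i ∈ E', (f' i).card = s) →
      (∀ u, ((E'.filter (fun i => u ∈ f' i)).card : ℝ) ≤ D') → j * (β * D / 4) ≤ E'.card →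
      (E'.card : ℝ) ≤ j * D →
      ∃ 𝒞 : Finset (Finset V), 𝒞.card ≤ (Fintype.card V + 1) ^ r * B ∧
        (∀ R ∈ 𝒞, δ * (Fintype.card V : ℝ) ≤ R.card ∧ ∀ u ∈ R, ∃ i ∈ E, u ∈ f i) ∧
        ∀ I : Finset V, (∀ i ∈ E, ¬ f i ⊆ I) → (∀ i ∈ E', ¬ f' i ⊆ I) →
          ∃ R ∈ 𝒞, Disjoint R I := by
  classical
  intro r
  induction r with
  | zero =>
    intro j hj E' f' h1 h2 h3 h4 h5 h6
    obtain rfl : j = q := by omega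
    obtain ⟨𝒞, a, b, d⟩ := hIH E' f' h1 h2 h3 h4 h5
    exact ⟨𝒞, by simpa using a, b, fun I _ h => d I h⟩
  | succ r ih =>
    intro j hj E' f' h1 h2 h3 h4 h5 h6
    have hA := mc_sizeA s j q E E' f f' D D' c β hD hD' hβ (by omega) hdeg hsize hc hq hsat h3 h6
    set A := E.filter (fun i => i ∉ E' ∧
      ∀ u ∈ f i, ((E'.filter (fun i => u ∈ f' i)).card : ℝ) + c ≤ D') with hAdef
    have hAE : A ⊆ E := Finset.filter_subset _ _
    have hAdeg : ∀ u, ((A.filter (fun i => u ∈ f i)).card : ℝ) ≤ D := fun u => by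
      refine le_trans ?_ (hdeg u)
      exact_mod_cast Finset.card_le_card (Finset.filter_subset_filter _ hAE)
    have hH := mc_high s A f (fun i hi => hE i (hAE hi)) D β hD hAdeg hA hβ
    set H := Finset.univ.filter (fun u => β * D / 4 ≤ ((A.filter (fun i => u ∈ f i)).card : ℝ))
      with hHdef
    have key : ∀ v ∈ H, ∃ 𝒞 : Finset (Finset V), 𝒞.card ≤ (Fintype.card V + 1) ^ r * B ∧
        (∀ R ∈ 𝒞, δ * (Fintype.card V : ℝ) ≤ R.card ∧ ∀ u ∈ R, ∃ i ∈ E, u ∈ f i) ∧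
        ∀ I : Finset V, v ∈ I → (∀ i ∈ E, ¬ f i ⊆ I) → (∀ i ∈ E', ¬ f' i ⊆ I) →
          ∃ R ∈ 𝒞, Disjoint R I := by
      intro v hv
      set Av := A.filter (fun i => v ∈ f i) with hAv
      have hvH : β * D / 4 ≤ (Av.card : ℝ) := by
        simpa [hHdef] using hv
      have hAvE : Av ⊆ E := (Finset.filter_subset _ _).trans hAE
      have hdisj : Disjoint E' Av := by
        rw [Finset.disjoint_right]
        intro i hi
        have : i ∈ A := Finset.filter_subset _ _ hi
        rw [hAdef, Finset.mem_filter] at this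
        exact this.2.1
      have hcard : ((E' ∪ Av).card : ℝ) = E'.card + Av.card := by
        rw [Finset.card_union_of_disjoint hdisj]; push_cast; rfl
      set g : ι → Finset V := fun i => if i ∈ Av then (f i).erase v else f' i with hg
      have hg1 : ∀ i ∈ Av, g i = (f i).erase v := fun i hi => by simp [hg, hi]
      have hg2 : ∀ i ∈ E', g i = f' i := fun i hi => by
        have : i ∉ Av := Finset.disjoint_left.1 hdisj hi
        simp [hg, this]
      have hvf : ∀ i ∈ Av, v ∈ f i := fun i hi => (Finset.mem_filter.1 hi).2
      obtain ⟨𝒞, a, b, d⟩ := ih (j + 1) (by omega) (E' ∪ Av) g (Finset.union_subset h1 hAvE)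
        (by
          intro i hi
          rcases Finset.mem_union.1 hi with hi | hi
          · rw [hg2 i hi]; exact h2 i hi
          · rw [hg1 i hi]; exact Finset.erase_subset _ _)
        (by
          intro i hi
          rcases Finset.mem_union.1 hi with hi | hi
          · rw [hg2 i hi]; exact h3 i hi
          · rw [hg1 i hi, Finset.card_erase_of_mem (hvf i hi), hE i (hAvE hi)]; simp)
        (by
          intro u
          have e1 : ((E' ∪ Av).filter (fun i => u ∈ g i)).card ≤
              (E'.filter (fun i => u ∈ f' i)).card + (Av.filter (fun i => u ∈ (f i).erase v)).card := by
            rw [Finset.filter_union]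
            refine (Finset.card_union_le _ _).trans ?_
            rw [Finset.filter_congr (s := E') (q := fun i => u ∈ f' i)
              (fun i hi => by rw [hg2 i hi]),
              Finset.filter_congr (s := Av) (q := fun i => u ∈ (f i).erase v)
              (fun i hi => by rw [hg1 i hi])]
          have e1' : (((E' ∪ Av).filter (fun i => u ∈ g i)).card : ℝ) ≤
              (E'.filter (fun i => u ∈ f' i)).card +
                ((Av.filter (fun i => u ∈ (f i).erase v)).card : ℝ) := by
            exact_mod_cast e1
          rcases (Av.filter (fun i => u ∈ (f i).erase v)).eq_empty_or_nonempty with e2 | ⟨i, hi⟩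
          · rw [e2] at e1'
            simp only [Finset.card_empty, Nat.cast_zero, add_zero] at e1'
            exact e1'.trans (h4 u)
          · obtain ⟨hi1, hi2⟩ := Finset.mem_filter.1 hi
            have huv : u ≠ v := Finset.ne_of_mem_erase hi2
            have huf : u ∈ f i := Finset.mem_of_mem_erase hi2
            have hiA : i ∈ A := Finset.filter_subset _ _ hi1
            rw [hAdef, Finset.mem_filter] at hiA
            have e3 := hiA.2.2 u huf
            have e4 : ((Av.filter (fun i => u ∈ (f i).erase v)).card : ℝ) ≤ c := by
              refine le_trans ?_ (hcod u v huv)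
              norm_cast
              refine Finset.card_le_card fun l hl => ?_
              obtain ⟨hl1, hl2⟩ := Finset.mem_filter.1 hl
              exact Finset.mem_filter.2 ⟨hAvE hl1, Finset.mem_of_mem_erase hl2, hvf l hl1⟩
            linarith)
        (by rw [hcard]; push_cast; linarith)
        (by rw [hcard]; push_cast; linarith [hAdeg v])
      refine ⟨𝒞, a, b, fun I hvI hI1 hI2 => d I hI1 fun i hi => ?_⟩
      rcases Finset.mem_union.1 hi with hi | hi
      · rw [hg2 i hi]; exact hI2 i hi
      · rw [hg1 i hi]
        intro hsub
        refine hI1 i (hAvE hi) ?_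
        rw [← Finset.insert_erase (hvf i hi)]
        exact Finset.insert_subset hvI hsub
    choose! 𝒞 k1 k2 k3 using key
    refine ⟨insert H (H.biUnion 𝒞), ?_, ?_, ?_⟩
    · have e1 : (H.biUnion 𝒞).card ≤ H.card * ((Fintype.card V + 1) ^ r * B) :=
        Finset.card_biUnion_le_card_mul _ _ _ k1
      have e2 : H.card ≤ Fintype.card V := Finset.card_le_univ _
      have e3 : 1 ≤ (Fintype.card V + 1) ^ r * B :=
        Nat.one_le_iff_ne_zero.2 (by positivity)
      calc (insert H (H.biUnion 𝒞)).card ≤ (H.biUnion 𝒞).card + 1 := Finset.card_insert_le _ _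
        _ ≤ Fintype.card V * ((Fintype.card V + 1) ^ r * B) + (Fintype.card V + 1) ^ r * B :=
          add_le_add (e1.trans (Nat.mul_le_mul_right _ e2)) e3
        _ = _ := by ring
    · intro R hR
      rcases Finset.mem_insert.1 hR with rfl | hR
      · refine ⟨?_, ?_⟩
        · refine le_trans ?_ hH
          have : (0 : ℝ) ≤ Fintype.card V := by positivity
          nlinarith
        · intro u hu
          have hu' : β * D / 4 ≤ ((A.filter (fun i => u ∈ f i)).card : ℝ) := by
            simpa [hHdef] using hu
          have : 0 < β * D / 4 := by positivity
          have h0 : (0 : ℝ) < ((A.filter (fun i => u ∈ f i)).card : ℝ) := by linarith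
          have h0' : 0 < (A.filter (fun i => u ∈ f i)).card := by exact_mod_cast h0
          obtain ⟨i, hi⟩ := Finset.card_pos.1 h0'
          obtain ⟨hi1, hi2⟩ := Finset.mem_filter.1 hi
          exact ⟨i, hAE hi1, hi2⟩
      · obtain ⟨v, hv, hR⟩ := Finset.mem_biUnion.1 hR
        exact k2 v hv R hR
    · intro I hI1 hI2
      by_cases hd : Disjoint H I
      · exact ⟨H, Finset.mem_insert_self _ _, hd⟩
      · obtain ⟨v, hv, hvI⟩ := Finset.not_disjoint_iff.1 hd
        obtain ⟨R, hR, hRI⟩ := k3 v hv I hvI hI1 hI2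
        exact ⟨R, Finset.mem_insert_of_mem (Finset.mem_biUnion.2 ⟨v, hv, hR⟩), hRI⟩

theorem mc_level (s : ℕ) : ∀ β : ℝ, 0 < β → ∃ δ τ₀ γ : ℝ, 0 < δ ∧ 0 < τ₀ ∧ 0 < γ ∧
    ∀ (V ι : Type) [Fintype V] [DecidableEq V] [DecidableEq ι] (q : ℕ) (D c : ℝ)
      (E : Finset ι) (f : ι → Finset V), 0 < D → 1 ≤ q → (q : ℝ) ≤ τ₀ * Fintype.card V →
      c ≤ γ * ((q : ℝ) / Fintype.card V) ^ s * D →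
      (∀ i ∈ E, (f i).card = s) →
      (∀ u, ((E.filter (fun i => u ∈ f i)).card : ℝ) ≤ D) →
      (∀ u w, u ≠ w → ((E.filter (fun i => u ∈ f i ∧ w ∈ f i)).card : ℝ) ≤ c) →
      β * D * (Fintype.card V : ℝ) ≤ E.card →
      ∃ 𝒞 : Finset (Finset V), 𝒞.card ≤ (Fintype.card V + 1) ^ (q * s) ∧
        (∀ R ∈ 𝒞, δ * (Fintype.card V : ℝ) ≤ R.card ∧ ∀ u ∈ R, ∃ i ∈ E, u ∈ f i) ∧
        ∀ I : Finset V, (∀ i ∈ E, ¬ f i ⊆ I) → ∃ R ∈ 𝒞, Disjoint R I := by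
  induction s with
  | zero =>
    intro β hβ
    refine ⟨1, 1, 1, one_pos, one_pos, one_pos, ?_⟩
    intro V ι _ _ _ q D c E f hD hq1 hq _ hE _ _ hsize
    refine ⟨∅, by simp, by simp, ?_⟩
    intro I hI
    exfalso
    have h1 : (1 : ℝ) ≤ q := by exact_mod_cast hq1
    have hM : (0 : ℝ) < Fintype.card V := by linarith
    have h2 : (0 : ℝ) < E.card := lt_of_lt_of_le (by positivity) hsize
    have h3 : 0 < E.card := by exact_mod_cast h2
    obtain ⟨i, hi⟩ := Finset.card_pos.1 h3
    have := hE i hi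
    rw [Finset.card_eq_zero] at this
    exact hI i hi (by simp [this])
  | succ s ih =>
    intro β hβ
    obtain ⟨δ', τ', γ', hδ', hτ', hγ', IH⟩ := ih (β ^ 2 / (32 * ((s : ℝ) + 1))) (by positivity)
    have hs : (0 : ℝ) < (s : ℝ) + 1 := by positivity
    refine ⟨min δ' (β / 4), min τ' (min (β / 4) 1),
      min (γ' * (8 * ((s : ℝ) + 1) / β)) (4 * ((s : ℝ) + 1) / β), by positivity, by positivity,
      by positivity, ?_⟩
    intro V ι _ _ _ q D c E f hD hq1 hq hc hE hdeg hcod hsize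
    have h1 : (1 : ℝ) ≤ q := by exact_mod_cast hq1
    have hM0 : (0 : ℝ) ≤ Fintype.card V := by positivity
    have hM : (0 : ℝ) < Fintype.card V := by
      rcases hM0.eq_or_lt with h | h
      · rw [← h] at hq; linarith
      · exact h
    set M : ℝ := (Fintype.card V : ℝ) with hMdef
    have hqa : (q : ℝ) ≤ τ' * M := hq.trans (by gcongr; exact min_le_left _ _)
    have hqb : (q : ℝ) ≤ β / 4 * M :=
      hq.trans (by gcongr; exact (min_le_right _ _).trans (min_le_left _ _))
    have hqc : (q : ℝ) ≤ 1 * M :=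
      hq.trans (by gcongr; exact (min_le_right _ _).trans (min_le_right _ _))
    set x : ℝ := (q : ℝ) / M with hx
    have hx0 : 0 < x := by positivity
    have hx1 : x ≤ 1 := by rw [hx, div_le_one hM]; linarith
    set D' : ℝ := 8 * ((s : ℝ) + 1) * x * D / β with hD'
    have hD'0 : 0 < D' := by positivity
    have hca : c ≤ γ' * x ^ s * D' := by
      refine hc.trans ?_
      calc min (γ' * (8 * ((s : ℝ) + 1) / β)) (4 * ((s : ℝ) + 1) / β) * x ^ (s + 1) * D
          ≤ (γ' * (8 * ((s : ℝ) + 1) / β)) * x ^ (s + 1) * D := by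
            gcongr; exact min_le_left _ _
        _ = _ := by rw [hD']; ring
    have hcb : c ≤ D' / 2 := by
      refine hc.trans ?_
      calc min (γ' * (8 * ((s : ℝ) + 1) / β)) (4 * ((s : ℝ) + 1) / β) * x ^ (s + 1) * D
          ≤ (4 * ((s : ℝ) + 1) / β) * x ^ (s + 1) * D := by
            gcongr; exact min_le_right _ _
        _ = (4 * ((s : ℝ) + 1) / β) * (x ^ s * x) * D := by ring
        _ ≤ (4 * ((s : ℝ) + 1) / β) * (1 * x) * D := by
            gcongr; exact pow_le_one₀ hx0.le hx1
        _ = _ := by rw [hD']; ring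
    have hxM : x * M = q := by rw [hx]; field_simp
    have hβD' : β * D' = 8 * ((s : ℝ) + 1) * x * D := by rw [hD']; field_simp
    have main := mc_inner s q ((Fintype.card V + 1) ^ (q * s))
      (Nat.one_le_iff_ne_zero.2 (by positivity)) E f D D' c β (min δ' (β / 4)) hD hD'0 hβ hE hdeg
      hcod hsize hcb (by linarith)
      (by
        have : β * M * D' = 8 * ((s : ℝ) + 1) * q * D := by
          rw [← hxM]; linear_combination M * hβD'
        rw [← hMdef, this]
        gcongr
        linarith)
      (min_le_right _ _)
      (by
        intro E' f' a1 a2 a3 a4 a5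
        obtain ⟨𝒞, b1, b2, b3⟩ := IH V ι q D' c E' f' hD'0 hq1 hqa hca a3 a4
          (fun u w huw => by
            refine le_trans ?_ (hcod u w huw)
            norm_cast
            refine Finset.card_le_card fun i hi => ?_
            simp only [Finset.mem_filter] at hi ⊢
            exact ⟨a1 hi.1, a2 i hi.1 hi.2.1, a2 i hi.1 hi.2.2⟩)
          (by
            refine le_trans (le_of_eq ?_) a5
            rw [← hMdef, ← hxM, hD']
            field_simp
            ring)
        refine ⟨𝒞, b1, fun R hR => ⟨?_, fun u hu => ?_⟩, b3⟩
        · refine le_trans ?_ (b2 R hR).1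
          gcongr
          exact min_le_left _ _
        · obtain ⟨i, hi, hui⟩ := (b2 R hR).2 u hu
          exact ⟨i, a1 hi, a2 i hi hui⟩)
      q 0 (by omega) ∅ f (by simp) (by simp) (by simp) (by intro u; simpa using hD'0.le) (by simp) (by simp)
    obtain ⟨𝒞, b1, b2, b3⟩ := main
    refine ⟨𝒞, ?_, b2, fun I hI => b3 I hI (by simp)⟩
    rw [← pow_add] at b1
    convert b1 using 2
    ring

theorem mc_abs (m : ℕ) (hm : 1 ≤ m) (β : ℝ) (hβ : 0 < β) : ∃ (J : ℕ) (τ₀ γ : ℝ),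
    0 < τ₀ ∧ 0 < γ ∧
    ∀ (V ι : Type) [Fintype V] [DecidableEq V] [DecidableEq ι] (q : ℕ) (D c : ℝ)
      (E : Finset ι) (f : ι → Finset V), 0 < D → 1 ≤ q → (q : ℝ) ≤ τ₀ * Fintype.card V →
      c ≤ γ * ((q : ℝ) / Fintype.card V) ^ m * D →
      (∀ i ∈ E, (f i).card = m) →
      (∀ u, ((E.filter (fun i => u ∈ f i)).card : ℝ) ≤ D) →
      (∀ u w, u ≠ w → ((E.filter (fun i => u ∈ f i ∧ w ∈ f i)).card : ℝ) ≤ c) →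
      ∃ 𝒯 : Finset (Finset V), 𝒯.card ≤ (Fintype.card V + 1) ^ (q * m * J) ∧
        (∀ C ∈ 𝒯, ((E.filter (fun i => f i ⊆ C)).card : ℝ) ≤ β * D * (Fintype.card V : ℝ)) ∧
        ∀ I : Finset V, (∀ i ∈ E, ¬ f i ⊆ I) → ∃ C ∈ 𝒯, I ⊆ C := by
  obtain ⟨δ, τ₀, γ, hδ, hτ₀, hγ, H⟩ := mc_level m β hβ
  obtain ⟨J, hJ⟩ := exists_nat_ge (1 / δ)
  refine ⟨J, τ₀, γ, hτ₀, hγ, ?_⟩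
  intro V ι _ _ _ q D c E f hD hq1 hq hc hE hdeg hcod
  have main : ∀ (j : ℕ) (C : Finset V), (C.card : ℝ) ≤ j * (δ * Fintype.card V) →
      ∃ 𝒯 : Finset (Finset V), 𝒯.card ≤ (Fintype.card V + 1) ^ (q * m * j) ∧
        (∀ C ∈ 𝒯, ((E.filter (fun i => f i ⊆ C)).card : ℝ) ≤ β * D * (Fintype.card V : ℝ)) ∧
        ∀ I : Finset V, I ⊆ C → (∀ i ∈ E, ¬ f i ⊆ I) → ∃ C ∈ 𝒯, I ⊆ C := by
    intro j
    induction j with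
    | zero =>
      intro C hC
      have hC0 : C = ∅ := by
        simp only [Nat.cast_zero, zero_mul] at hC
        have : C.card ≤ 0 := by exact_mod_cast hC
        simpa using this
      subst hC0
      refine ⟨{∅}, by simp, ?_, fun I hI _ => ⟨∅, by simp, hI⟩⟩
      intro C hC
      rw [Finset.mem_singleton] at hC
      subst hC
      rw [Finset.filter_false_of_mem]
      · simp; positivity
      · intro i hi h
        have := hE i hi
        rw [Finset.subset_empty.1 h] at this
        simp at this
        omega
    | succ j ih =>
      intro C hC
      by_cases hsm : ((E.filter (fun i => f i ⊆ C)).card : ℝ) ≤ β * D * (Fintype.card V : ℝ)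
      · refine ⟨{C}, ?_, ?_, fun I hI _ => ⟨C, by simp, hI⟩⟩
        · simp only [Finset.card_singleton]
          exact Nat.one_le_iff_ne_zero.2 (by positivity)
        · intro C' hC'
          rw [Finset.mem_singleton] at hC'
          subst hC'
          exact hsm
      · have hsub : E.filter (fun i => f i ⊆ C) ⊆ E := Finset.filter_subset _ _
        obtain ⟨ℛ, r1, r2, r3⟩ := H V ι q D c (E.filter (fun i => f i ⊆ C)) f hD hq1 hq hc
          (fun i hi => hE i (hsub hi))
          (fun u => le_trans (by
            exact_mod_cast Finset.card_le_card (Finset.filter_subset_filter _ hsub)) (hdeg u))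
          (fun u w huw => le_trans (by
            exact_mod_cast Finset.card_le_card (Finset.filter_subset_filter _ hsub)) (hcod u w huw))
          (not_le.1 hsm).le
        have key : ∀ R ∈ ℛ, ∃ 𝒯 : Finset (Finset V),
            𝒯.card ≤ (Fintype.card V + 1) ^ (q * m * j) ∧
            (∀ C ∈ 𝒯, ((E.filter (fun i => f i ⊆ C)).card : ℝ) ≤ β * D * (Fintype.card V : ℝ)) ∧
            ∀ I : Finset V, I ⊆ C \ R → (∀ i ∈ E, ¬ f i ⊆ I) → ∃ C ∈ 𝒯, I ⊆ C := by
          intro R hR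
          refine ih (C \ R) ?_
          have hRC : R ⊆ C := fun u hu => by
            obtain ⟨i, hi, hui⟩ := (r2 R hR).2 u hu
            exact (Finset.mem_filter.1 hi).2 hui
          have h1 := (r2 R hR).1
          have h2 := Finset.card_sdiff_add_card_eq_card hRC
          have h3 : ((C \ R).card : ℝ) + R.card = C.card := by exact_mod_cast h2
          push_cast at hC
          linarith
        choose! 𝒯 t1 t2 t3 using key
        refine ⟨ℛ.biUnion 𝒯, ?_, ?_, ?_⟩
        · refine (Finset.card_biUnion_le_card_mul _ _ _ t1).trans ?_
          calc ℛ.card * (Fintype.card V + 1) ^ (q * m * j) ≤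
              (Fintype.card V + 1) ^ (q * m) * (Fintype.card V + 1) ^ (q * m * j) :=
                Nat.mul_le_mul_right _ r1
            _ = _ := by rw [← pow_add]; congr 1; ring
        · intro C' hC'
          obtain ⟨R, hR, h⟩ := Finset.mem_biUnion.1 hC'
          exact t2 R hR C' h
        · intro I hIC hI
          obtain ⟨R, hR, hd⟩ := r3 I (fun i hi => hI i (hsub hi))
          obtain ⟨C', hC', h⟩ := t3 R hR I (by
            rw [Finset.subset_sdiff]; exact ⟨hIC, hd.symm⟩) hI
          exact ⟨C', Finset.mem_biUnion.2 ⟨R, hR, hC'⟩, h⟩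
  obtain ⟨𝒯, t1, t2, t3⟩ := main J Finset.univ (by
    rw [Finset.card_univ]
    have : 1 ≤ J * δ := by
      rw [div_le_iff₀ hδ] at hJ; exact hJ
    have h0 : (0 : ℝ) ≤ Fintype.card V := by positivity
    nlinarith)
  exact ⟨𝒯, t1, t2, fun I hI => t3 I (Finset.subset_univ _) hI⟩

theorem mc_card_edge (n : ℕ) : Fintype.card (Edge n) = n.choose 2 := by
  rw [Fintype.card_subtype]
  have : (Finset.univ.filter (fun p : Fin n × Fin n => p.1 < p.2)).card =
      ∑ b : Fin n, (Finset.univ.filter (fun a : Fin n => a < b)).card := by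
    rw [Finset.card_filter, Fintype.sum_prod_type_right]
    simp_rw [Finset.card_filter]
  rw [this, Nat.choose_two_right, ← Finset.sum_range_id, Finset.sum_range]
  refine Finset.sum_congr rfl fun b _ => ?_
  rw [Finset.filter_gt_eq_Iio, Fin.card_Iio]

theorem mc_map_inj {m n : ℕ} (φ : Fin m → Fin n) (h : StrictMono φ) :
    Function.Injective (Edge.map φ h) := by
  intro a b hab
  simp only [Edge.map, Subtype.mk.injEq, Prod.mk.injEq] at hab
  exact Subtype.ext (Prod.ext (h.injective hab.1) (h.injective hab.2))

theorem mc_cnt {N n : ℕ} (S : Finset (Fin N)) (g : Fin N → Fin n) :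
    (Finset.univ.filter (fun φ : Fin N ↪o Fin n => ∀ i ∈ S, φ i = g i)).card ≤ n ^ (N - S.card) := by
  classical
  have h1 : (Finset.univ.filter (fun φ : Fin N ↪o Fin n => ∀ i ∈ S, φ i = g i)).card ≤
      (Fintype.piFinset (fun i : Fin N => if i ∈ S then {g i} else (Finset.univ : Finset (Fin n)))).card := by
    refine Finset.card_le_card_of_injOn (fun φ i => φ i) ?_ ?_
    · intro φ hφ
      simp only [Finset.coe_filter, Finset.mem_univ, true_and, Set.mem_ofPred_eq] at hφ
      simp only [Finset.mem_coe, Fintype.mem_piFinset]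
      intro i
      by_cases hi : i ∈ S
      · simp [hi, hφ i hi]
      · simp [hi]
    · intro φ _ ψ _ h
      exact DFunLike.ext _ _ (fun i => congrFun h i)
  refine h1.trans (le_of_eq ?_)
  rw [Fintype.card_piFinset]
  have : ∀ i : Fin N, (if i ∈ S then {g i} else (Finset.univ : Finset (Fin n))).card =
      if i ∈ S then 1 else n := fun i => by split_ifs <;> simp
  simp_rw [this]
  rw [Finset.prod_ite]
  simp only [Finset.prod_const, one_pow, one_mul]
  congr 1
  rw [Finset.filter_not, Finset.filter_mem_eq_inter, Finset.univ_inter,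
    Finset.card_sdiff_of_subset (Finset.subset_univ _)]
  simp

/-- The hyperedge of a pair (embedding, colouring). -/
def mcEdge {k N n : ℕ} (p : (Fin N ↪o Fin n) × Colouring k N) : Finset (Edge n × Fin k) :=
  Finset.univ.image (fun e => (Edge.map p.1 p.1.strictMono e, p.2 e))

theorem mc_mem {k N n : ℕ} (p : (Fin N ↪o Fin n) × Colouring k N) (u : Edge n × Fin k) :
    u ∈ mcEdge p ↔ ∃ e, Edge.map p.1 p.1.strictMono e = u.1 ∧ p.2 e = u.2 := by
  simp [mcEdge, Prod.ext_iff]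

theorem mc_card {k N n : ℕ} (p : (Fin N ↪o Fin n) × Colouring k N) :
    (mcEdge p).card = N.choose 2 := by
  rw [mcEdge, Finset.card_image_of_injective, Finset.card_univ, mc_card_edge]
  intro a b hab
  exact mc_map_inj p.1 p.1.strictMono (Prod.ext_iff.1 hab).1

theorem mc_map_eq {N n : ℕ} (φ ψ : Fin N ↪o Fin n) (e : Edge N) :
    Edge.map φ φ.strictMono e = Edge.map ψ ψ.strictMono e ↔
      φ e.1.1 = ψ e.1.1 ∧ φ e.1.2 = ψ e.1.2 := by
  simp [Edge.map]

theorem mc_deg1 {N n : ℕ} (e : Edge N) (x : Edge n) :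
    (Finset.univ.filter (fun φ : Fin N ↪o Fin n => Edge.map φ φ.strictMono e = x)).card ≤
      n ^ (N - 2) := by
  classical
  rcases (Finset.univ.filter
    (fun φ : Fin N ↪o Fin n => Edge.map φ φ.strictMono e = x)).eq_empty_or_nonempty with h | ⟨ψ, hψ⟩
  · rw [h]; simp
  · have hψ' : Edge.map ψ ψ.strictMono e = x := by simpa using hψ
    have h2 : ({e.1.1, e.1.2} : Finset (Fin N)).card = 2 := Finset.card_pair e.2.ne
    rw [← h2]
    refine le_trans (Finset.card_le_card ?_) (mc_cnt _ ψ)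
    intro φ hφ
    have hφ' : Edge.map φ φ.strictMono e = x := by simpa using hφ
    rw [← hψ', mc_map_eq] at hφ'
    simp [hφ'.1, hφ'.2]

theorem mc_deg2 {N n : ℕ} (hn : 1 ≤ n) (e e' : Edge N) (hee : e ≠ e') (x y : Edge n) :
    (Finset.univ.filter (fun φ : Fin N ↪o Fin n => Edge.map φ φ.strictMono e = x ∧
      Edge.map φ φ.strictMono e' = y)).card ≤ n ^ (N - 3) := by
  classical
  rcases (Finset.univ.filter
    (fun φ : Fin N ↪o Fin n => Edge.map φ φ.strictMono e = x ∧
      Edge.map φ φ.strictMono e' = y)).eq_empty_or_nonempty with h | ⟨ψ, hψ⟩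
  · rw [h]; simp
  · have hψ' : Edge.map ψ ψ.strictMono e = x ∧ Edge.map ψ ψ.strictMono e' = y := by
      simpa using hψ
    set S : Finset (Fin N) := {e.1.1, e.1.2, e'.1.1, e'.1.2} with hS
    have h3 : 3 ≤ S.card := by
      by_contra hlt
      have h2 : ({e.1.1, e.1.2} : Finset (Fin N)).card = 2 := Finset.card_pair e.2.ne
      have hsub : ({e.1.1, e.1.2} : Finset (Fin N)) ⊆ S := by
        intro i; simp only [hS, Finset.mem_insert, Finset.mem_singleton]; tauto
      have heq := Finset.eq_of_subset_of_card_le hsub (by omega)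
      have m1 : e'.1.1 ∈ ({e.1.1, e.1.2} : Finset (Fin N)) := by rw [heq]; simp [hS]
      have m2 : e'.1.2 ∈ ({e.1.1, e.1.2} : Finset (Fin N)) := by rw [heq]; simp [hS]
      simp only [Finset.mem_insert, Finset.mem_singleton] at m1 m2
      have l1 := e.2
      have l2 := e'.2
      apply hee
      rcases m1 with m1 | m1 <;> rcases m2 with m2 | m2
      · rw [m1, m2] at l2; exact absurd l2 (lt_irrefl _)
      · exact Subtype.ext (Prod.ext m1.symm m2.symm)
      · rw [m1, m2] at l2; exact absurd l2 (lt_asymm l1)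
      · rw [m1, m2] at l2; exact absurd l2 (lt_irrefl _)
    refine le_trans (Finset.card_le_card ?_) ((mc_cnt S ψ).trans (Nat.pow_le_pow_right hn (by omega)))
    intro φ hφ
    have hφ' : Edge.map φ φ.strictMono e = x ∧ Edge.map φ φ.strictMono e' = y := by
      simpa using hφ
    rw [← hψ'.1, ← hψ'.2, mc_map_eq, mc_map_eq] at hφ'
    simp [hS, hφ'.1.1, hφ'.1.2, hφ'.2.1, hφ'.2.2]

theorem mc_degree {k N n : ℕ} (E : Finset ((Fin N ↪o Fin n) × Colouring k N)) (u : Edge n × Fin k) :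
    (E.filter (fun p => u ∈ mcEdge p)).card ≤
      N.choose 2 * (n ^ (N - 2) * Fintype.card (Colouring k N)) := by
  classical
  have h1 : E.filter (fun p => u ∈ mcEdge p) ⊆ (Finset.univ : Finset (Edge N)).biUnion (fun e =>
      (Finset.univ.filter (fun φ : Fin N ↪o Fin n => Edge.map φ φ.strictMono e = u.1)) ×ˢ
        (Finset.univ : Finset (Colouring k N))) := by
    intro p hp
    obtain ⟨e, he, _⟩ := (mc_mem p u).1 (Finset.mem_filter.1 hp).2
    simp only [Finset.mem_biUnion, Finset.mem_univ, true_and, Finset.mem_product,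
      Finset.mem_filter, and_true]
    exact ⟨e, he⟩
  refine (Finset.card_le_card h1).trans ?_
  rw [← mc_card_edge N, ← Finset.card_univ]
  refine Finset.card_biUnion_le_card_mul _ _ _ fun e _ => ?_
  rw [Finset.card_product, Finset.card_univ]
  exact Nat.mul_le_mul_right _ (mc_deg1 e u.1)

theorem mc_codegree {k N n : ℕ} (hn : 1 ≤ n) (E : Finset ((Fin N ↪o Fin n) × Colouring k N))
    (u w : Edge n × Fin k) (huw : u ≠ w) :
    (E.filter (fun p => u ∈ mcEdge p ∧ w ∈ mcEdge p)).card ≤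
      (N.choose 2 * N.choose 2) * (n ^ (N - 3) * Fintype.card (Colouring k N)) := by
  classical
  have h1 : E.filter (fun p => u ∈ mcEdge p ∧ w ∈ mcEdge p) ⊆
      ((Finset.univ : Finset (Edge N × Edge N)).filter (fun z => z.1 ≠ z.2)).biUnion (fun z =>
      (Finset.univ.filter (fun φ : Fin N ↪o Fin n => Edge.map φ φ.strictMono z.1 = u.1 ∧
        Edge.map φ φ.strictMono z.2 = w.1)) ×ˢ
        (Finset.univ : Finset (Colouring k N))) := by
    intro p hp
    obtain ⟨e, he, hc⟩ := (mc_mem p u).1 (Finset.mem_filter.1 hp).2.1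
    obtain ⟨e', he', hc'⟩ := (mc_mem p w).1 (Finset.mem_filter.1 hp).2.2
    simp only [Finset.mem_biUnion, Finset.mem_univ, true_and, Finset.mem_product,
      Finset.mem_filter, and_true]
    refine ⟨(e, e'), ?_, he, he'⟩
    intro hee
    have hee' : e = e' := hee
    subst hee'
    exact huw (Prod.ext (he.symm.trans he') (hc.symm.trans hc'))
  refine (Finset.card_le_card h1).trans ?_
  have h2 : ((Finset.univ : Finset (Edge N × Edge N)).filter (fun z => z.1 ≠ z.2)).card ≤
      N.choose 2 * N.choose 2 := by
    refine (Finset.card_le_univ _).trans ?_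
    rw [Fintype.card_prod, mc_card_edge]
  refine le_trans (Finset.card_biUnion_le_card_mul _ _
    (n ^ (N - 3) * Fintype.card (Colouring k N)) fun z hz => ?_) (Nat.mul_le_mul_right _ h2)
  rw [Finset.card_product, Finset.card_univ]
  exact Nat.mul_le_mul_right _ (mc_deg2 hn z.1 z.2 (Finset.mem_filter.1 hz).2 u.1 w.1)

/-- The template of a vertex set. -/
noncomputable def mcTemp {k n : ℕ} (C : Finset (Edge n × Fin k)) : Template k n :=
  fun e => Finset.univ.filter (fun a => (e, a) ∈ C)

theorem mc_bad {k N n : ℕ} (F : Set (Colouring k N)) (E : Finset ((Fin N ↪o Fin n) × Colouring k N))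
    (hE : ∀ p, p ∈ E ↔ p.2 ∈ F) (C : Finset (Edge n × Fin k)) :
    badPairs (mcTemp C) F ≤ (E.filter (fun p => mcEdge p ⊆ C)).card := by
  classical
  have h : {p : (Fin N → Fin n) × Colouring k N |
      ∃ h : StrictMono p.1, p.2 ∈ F ∧ Realises p.2 (restrictT (mcTemp C) p.1 h)} ⊆
      ((E.filter (fun p => mcEdge p ⊆ C)).image
        (fun p => ((p.1 : Fin N → Fin n), p.2)) : Finset ((Fin N → Fin n) × Colouring k N)) := by
    rintro ⟨φ, c⟩ ⟨hm, hc, hr⟩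
    simp only [Finset.coe_image, Set.mem_image, Finset.mem_coe, Finset.mem_filter]
    refine ⟨(OrderEmbedding.ofStrictMono φ hm, c), ⟨(hE _).2 hc, ?_⟩, rfl⟩
    intro u hu
    obtain ⟨e, he1, he2⟩ := (mc_mem _ _).1 hu
    have := hr e
    simp only [restrictT, mcTemp, Finset.mem_filter, Finset.mem_univ, true_and] at this
    have hu' : u = (Edge.map φ hm e, c e) := Prod.ext he1.symm he2.symm
    rw [hu']; exact this
  rw [badPairs]
  refine (Set.ncard_le_ncard h (Finset.finite_toSet _)).trans ?_
  rw [Set.ncard_coe_finset]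
  exact Finset.card_image_le

theorem mc_indep {k N n : ℕ} (F : Set (Colouring k N)) (t : Template k n) (ht : Proper t)
    (hF : ∀ c, Realises c t → c ∈ Forb F n) (p : (Fin N ↪o Fin n) × Colouring k N) (hp : p.2 ∈ F) :
    ¬ mcEdge p ⊆ Finset.univ.filter (fun u : Edge n × Fin k => u.2 ∈ t u.1) := by
  classical
  intro hsub
  choose d hd using ht
  have hinj := mc_map_inj p.1 p.1.strictMono
  let c : Colouring k n := fun x =>
    if h : ∃ e, Edge.map p.1 p.1.strictMono e = x then p.2 h.choose else d x
  have hc : ∀ e, c (Edge.map p.1 p.1.strictMono e) = p.2 e := by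
    intro e
    have h : ∃ e', Edge.map p.1 p.1.strictMono e' = Edge.map p.1 p.1.strictMono e := ⟨e, rfl⟩
    simp only [c, dif_pos h]
    rw [hinj h.choose_spec]
  have hr : Realises c t := by
    intro x
    by_cases h : ∃ e, Edge.map p.1 p.1.strictMono e = x
    · obtain ⟨e, rfl⟩ := h
      rw [hc]
      have := hsub ((mc_mem p (Edge.map p.1 p.1.strictMono e, p.2 e)).2 ⟨e, rfl, rfl⟩)
      simpa using this
    · simp only [c, dif_neg h]
      exact hd x
  refine hF c hr p.1 p.1.strictMono ?_
  have : restrictC c p.1 p.1.strictMono = p.2 := funext hc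
  rw [this]; exact hp

/-- From vertex-set containers to template containers. -/
theorem mc_transfer {k N n : ℕ} (F : Set (Colouring k N))
    (E : Finset ((Fin N ↪o Fin n) × Colouring k N)) (hE : ∀ p, p ∈ E ↔ p.2 ∈ F)
    (𝒯 : Finset (Finset (Edge n × Fin k))) (x : ℝ)
    (h1 : ∀ C ∈ 𝒯, ((E.filter (fun p => mcEdge p ⊆ C)).card : ℝ) ≤ x)
    (h2 : ∀ I : Finset (Edge n × Fin k), (∀ p ∈ E, ¬ mcEdge p ⊆ I) → ∃ C ∈ 𝒯, I ⊆ C) :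
    ∃ T : Finset (Template k n), (∀ t ∈ T, Proper t) ∧ IsContainerFamily T (Forb F n) ∧
      (∀ t ∈ T, (badPairs t F : ℝ) ≤ x) ∧ T.card ≤ 𝒯.card := by
  classical
  refine ⟨(𝒯.image mcTemp).filter Proper, fun t ht => (Finset.mem_filter.1 ht).2, ?_, ?_, ?_⟩
  · intro t ht hF
    obtain ⟨C, hC, hIC⟩ := h2 (Finset.univ.filter (fun u : Edge n × Fin k => u.2 ∈ t u.1))
      (fun p hp => mc_indep F t ht hF p ((hE p).1 hp))
    have hsub : ∀ e, t e ⊆ mcTemp C e := by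
      intro e a ha
      simp only [mcTemp, Finset.mem_filter, Finset.mem_univ, true_and]
      exact hIC (by simpa using ha)
    refine ⟨mcTemp C, ?_, id, strictMono_id, fun e => hsub e⟩
    rw [Finset.mem_filter]
    exact ⟨Finset.mem_image_of_mem _ hC, fun e => (ht e).mono (hsub e)⟩
  · intro t ht
    obtain ⟨C, hC, rfl⟩ := Finset.mem_image.1 (Finset.mem_filter.1 ht).1
    refine le_trans ?_ (h1 C hC)
    exact_mod_cast mc_bad F E hE C
  · exact (Finset.card_filter_le _ _).trans Finset.card_image_le

theorem mc_asym (m k : ℕ) (hm : 3 ≤ m) (τ₀ γ : ℝ) (hτ : 0 < τ₀) (hγ : 0 < γ) :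
    ∃ n₀ : ℕ, ∀ n : ℕ, n₀ ≤ n →
      2 * (n : ℝ) ^ (-(1 / ((m : ℝ) + 1))) ≤ τ₀ ∧
      1 ≤ γ * ((n : ℝ) ^ (-(1 / ((m : ℝ) + 1)))) ^ m * n ∧
      (n : ℝ) ^ (-(1 / ((m : ℝ) + 1))) * (1 + 2 * Real.logb k n) ≤
        (n : ℝ) ^ (-(1 / (2 * (m : ℝ) - 1))) := by
  have hm' : (3 : ℝ) ≤ m := by exact_mod_cast hm
  set ρ : ℝ := 1 / ((m : ℝ) + 1) with hρ
  have hρ0 : 0 < ρ := by positivity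
  have hσ : 0 < ρ - 1 / (2 * (m : ℝ) - 1) := by
    rw [hρ, sub_pos]
    exact one_div_lt_one_div_of_lt (by positivity) (by linarith)
  have e1 : ∀ᶠ x : ℝ in atTop, 2 * x ^ (-ρ) ≤ τ₀ := by
    have h := (tendsto_rpow_neg_atTop hρ0).const_mul 2
    rw [mul_zero] at h
    exact h.eventually_le_const hτ
  have e2 : ∀ᶠ x : ℝ in atTop, 1 ≤ γ * (x ^ (-ρ)) ^ m * x := by
    have h := (tendsto_rpow_atTop hρ0).const_mul_atTop hγ
    filter_upwards [h.eventually_ge_atTop 1, eventually_gt_atTop 0] with x hx hx0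
    refine hx.trans (le_of_eq ?_)
    rw [mul_assoc, ← Real.rpow_mul_natCast hx0.le, ← Real.rpow_add_one hx0.ne']
    congr 2
    rw [hρ]; field_simp; ring
  have e3 : ∀ᶠ x : ℝ in atTop, x ^ (-ρ) * (1 + 2 * Real.logb k x) ≤
      x ^ (-(1 / (2 * (m : ℝ) - 1))) := by
    have h1 : (fun x : ℝ => 1 + 2 * Real.logb k x) =o[atTop]
        (fun x : ℝ => x ^ (ρ - 1 / (2 * (m : ℝ) - 1))) := by
      refine Asymptotics.IsLittleO.add ?_ ?_
      · refine Asymptotics.isLittleO_const_left.2 (Or.inr ?_)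
        exact tendsto_norm_atTop_atTop.comp (tendsto_rpow_atTop hσ)
      · have := (isLittleO_log_rpow_atTop hσ).const_mul_left (2 / Real.log k)
        refine this.congr_left fun x => ?_
        simp only [Real.logb]; ring
    filter_upwards [h1.bound one_pos, eventually_gt_atTop 0] with x hx hx0
    rw [Real.norm_eq_abs, Real.norm_eq_abs, one_mul, abs_of_pos (Real.rpow_pos_of_pos hx0 _)] at hx
    calc x ^ (-ρ) * (1 + 2 * Real.logb k x) ≤ x ^ (-ρ) * x ^ (ρ - 1 / (2 * (m : ℝ) - 1)) := by
          gcongr; exact (le_abs_self _).trans hx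
      _ = _ := by rw [← Real.rpow_add hx0]; congr 1; ring
  have h := tendsto_natCast_atTop_atTop.eventually (e1.and (e2.and e3))
  obtain ⟨n₀, hn₀⟩ := eventually_atTop.1 h
  exact ⟨n₀, fun n hn => hn₀ n hn⟩

theorem mc_choose (N n : ℕ) (hn : 2 * N ≤ n) :
    (n : ℝ) ^ N ≤ 2 ^ N * (N.factorial : ℝ) * (n.choose N : ℝ) := by
  have h := Nat.pow_le_choose (α := ℝ) N n
  have h1 : (n : ℝ) / 2 ≤ ((n + 1 - N : ℕ) : ℝ) := by
    have : (n : ℝ) ≤ ((2 * (n + 1 - N) : ℕ) : ℝ) := by exact_mod_cast (by omega)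
    push_cast at this ⊢
    linarith
  have h2 : ((n : ℝ) / 2) ^ N ≤ ((n + 1 - N : ℕ) : ℝ) ^ N := by gcongr
  have h3 : ((n : ℝ) / 2) ^ N ≤ (n.choose N : ℝ) * (N.factorial : ℝ) := by
    refine h2.trans ?_
    first
      | exact_mod_cast h
      | (rw [mul_comm]; exact_mod_cast h)
      | (rw [le_div_iff₀ (by positivity)] at h; exact_mod_cast h)
      | (rw [div_le_iff₀ (by positivity)] at h; exact_mod_cast h)
  rw [div_pow, div_le_iff₀ (by positivity)] at h3
  linarith

set_option maxHeartbeats 2000000 in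
theorem mc_big (k N : ℕ) (hk : 2 ≤ k) (hN : 3 ≤ N)
    (F : Set (Colouring k N)) (hF : F.Nonempty) (ε : ℝ) (hε : 0 < ε) :
    ∃ (C₀ : ℝ) (n₀ : ℕ), 0 < C₀ ∧ ∀ n, n₀ ≤ n →
      ∃ T : Finset (Template k n),
        (∀ t ∈ T, Proper t) ∧
        IsContainerFamily T (Forb F n) ∧
        (∀ t ∈ T, (badPairs t F : ℝ) ≤ ε * (n.choose N : ℝ)) ∧
        Real.logb k (T.card : ℝ) ≤
          C₀ * (n : ℝ) ^ (-(1 / (2 * (N.choose 2 : ℝ) - 1))) * (n.choose 2 : ℝ) := by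
  classical
  have hm : 3 ≤ N.choose 2 := by
    have := Nat.choose_le_choose 2 hN
    simpa using this
  set m := N.choose 2 with hmdef
  have hm0 : (0 : ℝ) < m := by exact_mod_cast (by omega : 0 < m)
  set κ : ℕ := Fintype.card (Colouring k N) with hκ
  have hκ1 : 0 < κ := Fintype.card_pos_iff.2 ⟨hF.some⟩
  have hκ0 : (0 : ℝ) < κ := by exact_mod_cast hκ1
  have hk0 : (0 : ℝ) < k := by exact_mod_cast (by omega : 0 < k)
  have hk1 : (1 : ℝ) < k := by exact_mod_cast (by omega : 1 < k)
  set K : ℝ := (m : ℝ) ^ 2 * κ with hK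
  have hK0 : 0 < K := by positivity
  obtain ⟨J, τ₀, γ, hτ₀, hγ, H⟩ := mc_abs m (by omega)
    (ε / (2 ^ N * (N.factorial : ℝ) * (K * k))) (by positivity)
  obtain ⟨n₁, hn₁⟩ := mc_asym m k hm τ₀ γ hτ₀ hγ
  refine ⟨2 * k * m * J + 1, max n₁ (2 * N), by positivity, ?_⟩
  intro n hn
  have hnN : 2 * N ≤ n := (le_max_right _ _).trans hn
  have hn3 : 3 ≤ n := by omega
  obtain ⟨A1, A2, A3⟩ := hn₁ n ((le_max_left _ _).trans hn)
  have hn0 : (0 : ℝ) < n := by exact_mod_cast (by omega : 0 < n)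
  have hn1 : (1 : ℝ) ≤ n := by exact_mod_cast (by omega : 1 ≤ n)
  have hn3' : (3 : ℝ) ≤ n := by exact_mod_cast hn3
  set y : ℝ := (n : ℝ) ^ (-(1 / ((m : ℝ) + 1))) with hy
  have hy0 : 0 < y := Real.rpow_pos_of_pos hn0 _
  have hcardV : Fintype.card (Edge n × Fin k) = n.choose 2 * k := by
    rw [Fintype.card_prod, mc_card_edge, Fintype.card_fin]
  have hch : (n.choose 2 : ℝ) = n * (n - 1) / 2 := Nat.cast_choose_two ℝ n
  set M : ℝ := (n.choose 2 : ℝ) * k with hM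
  have hMc : ((Fintype.card (Edge n × Fin k) : ℕ) : ℝ) = M := by rw [hcardV]; push_cast; rfl
  have hk2 : (2 : ℝ) ≤ k := by exact_mod_cast hk
  have hchn : (n : ℝ) ≤ n.choose 2 := by rw [hch]; nlinarith
  have hMn : (n : ℝ) ≤ M := by nlinarith
  have hM0 : 0 < M := by linarith
  have hMy : 1 ≤ M * y := by
    have : 1 ≤ (n : ℝ) * y := by
      have h1 : (n : ℝ) ^ (-1 : ℝ) ≤ y := by
        apply Real.rpow_le_rpow_of_exponent_le hn1
        have : 1 / ((m : ℝ) + 1) ≤ 1 := by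
          rw [div_le_one (by positivity)]; linarith
        linarith
      rw [Real.rpow_neg_one] at h1
      calc (1 : ℝ) = n * (n : ℝ)⁻¹ := by field_simp
        _ ≤ _ := by gcongr
    exact this.trans (by gcongr)
  set q : ℕ := ⌈M * y⌉₊ with hq
  have hq1 : 1 ≤ q := Nat.one_le_iff_ne_zero.2 (Nat.ceil_pos.2 (by positivity)).ne'
  have hqlo : M * y ≤ q := Nat.le_ceil _
  have hqhi : (q : ℝ) ≤ 2 * (M * y) := by
    have := Nat.ceil_lt_add_one (by positivity : 0 ≤ M * y)
    rw [← hq] at this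
    linarith
  set E : Finset ((Fin N ↪o Fin n) × Colouring k N) := Finset.univ.filter (fun p => p.2 ∈ F)
    with hE
  have hE' : ∀ p, p ∈ E ↔ p.2 ∈ F := fun p => by simp [hE]
  have hpow : (n : ℝ) ^ (N - 2) = n ^ (N - 3) * n := by
    rw [← pow_succ]; congr 1; omega
  obtain ⟨𝒯, t1, t2, t3⟩ := H (Edge n × Fin k) ((Fin N ↪o Fin n) × Colouring k N) q
    (K * (n : ℝ) ^ (N - 2)) (K * (n : ℝ) ^ (N - 3)) E mcEdge (by positivity) hq1
    (by rw [hMc]; nlinarith)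
    (by
      rw [hMc, hpow]
      have h1 : y ≤ q / M := by rw [le_div_iff₀ hM0]; linarith
      calc K * (n : ℝ) ^ (N - 3) = 1 * (K * (n : ℝ) ^ (N - 3)) := by ring
        _ ≤ (γ * y ^ m * n) * (K * (n : ℝ) ^ (N - 3)) := by gcongr
        _ ≤ (γ * (q / M) ^ m * n) * (K * (n : ℝ) ^ (N - 3)) := by gcongr
        _ = _ := by ring)
    (fun p _ => mc_card p)
    (fun u => by
      have h := mc_degree E u
      have h2 : ((E.filter (fun p => u ∈ mcEdge p)).card : ℝ) ≤ m * (n ^ (N - 2) * κ) := by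
        exact_mod_cast h
      refine h2.trans ?_
      rw [hK]
      have : (m : ℝ) ≤ m ^ 2 := by
        have : (1 : ℝ) ≤ m := by exact_mod_cast (by omega : 1 ≤ m)
        nlinarith
      calc (m : ℝ) * (n ^ (N - 2) * κ) ≤ m ^ 2 * (n ^ (N - 2) * κ) := by gcongr
        _ = _ := by ring)
    (fun u w huw => by
      have h := mc_codegree (by omega) E u w huw
      have h2 : ((E.filter (fun p => u ∈ mcEdge p ∧ w ∈ mcEdge p)).card : ℝ) ≤
          (m * m) * (n ^ (N - 3) * κ) := by
        exact_mod_cast h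
      refine h2.trans (le_of_eq ?_)
      rw [hK]; ring)
  obtain ⟨T, T1, T2, T3, T4⟩ := mc_transfer F E hE' 𝒯 _ t2 t3
  refine ⟨T, T1, T2, fun t ht => (T3 t ht).trans ?_, ?_⟩
  · rw [hMc]
    have h1 := mc_choose N n hnN
    have h2 : M ≤ k * (n : ℝ) ^ 2 := by
      rw [hM, hch]; nlinarith
    have h3 : (n : ℝ) ^ (N - 2) * n ^ 2 = n ^ N := by
      rw [← pow_add]; congr 1; omega
    calc ε / (2 ^ N * (N.factorial : ℝ) * (K * k)) * (K * (n : ℝ) ^ (N - 2)) * M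
        ≤ ε / (2 ^ N * (N.factorial : ℝ) * (K * k)) * (K * (n : ℝ) ^ (N - 2)) *
          (k * (n : ℝ) ^ 2) := by gcongr
      _ = ε / (2 ^ N * (N.factorial : ℝ)) * n ^ N := by
          rw [← h3]; field_simp
      _ ≤ ε / (2 ^ N * (N.factorial : ℝ)) * (2 ^ N * (N.factorial : ℝ) * (n.choose N : ℝ)) := by
          gcongr
      _ = _ := by field_simp
  · set z : ℝ := (n : ℝ) ^ (-(1 / (2 * (m : ℝ) - 1))) with hz
    have hz0 : 0 < z := Real.rpow_pos_of_pos hn0 _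
    have hC0 : (0 : ℝ) ≤ n.choose 2 := by positivity
    rcases Nat.eq_zero_or_pos T.card with h0 | hpos
    · rw [h0]; simp only [Nat.cast_zero, Real.logb_zero]; positivity
    have hposR : (0 : ℝ) < T.card := by exact_mod_cast hpos
    have h1 : (T.card : ℝ) ≤ (M + 1) ^ (q * m * J) := by
      have := T4.trans t1
      rw [← hMc]
      exact_mod_cast this
    have h2 : Real.logb k (M + 1) ≤ 1 + 2 * Real.logb k n := by
      have h3 : M + 1 ≤ k * (n : ℝ) ^ 2 := by rw [hM, hch]; nlinarith
      refine (Real.logb_le_logb_of_le hk1 (by positivity) h3).trans (le_of_eq ?_)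
      rw [Real.logb_mul hk0.ne' (by positivity), Real.logb_self_eq_one hk1, Real.logb_pow]
      norm_num
    have hlog0 : 0 ≤ Real.logb k n := Real.logb_nonneg hk1 hn1
    calc Real.logb k (T.card : ℝ) ≤ Real.logb k ((M + 1) ^ (q * m * J)) :=
          Real.logb_le_logb_of_le hk1 hposR h1
      _ = (q * m * J) * Real.logb k (M + 1) := by rw [Real.logb_pow]; push_cast; ring
      _ ≤ (q * m * J) * (1 + 2 * Real.logb k n) := by gcongr
      _ ≤ (2 * (M * y) * m * J) * (1 + 2 * Real.logb k n) := by gcongr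
      _ = 2 * M * m * J * (y * (1 + 2 * Real.logb k n)) := by ring
      _ ≤ 2 * M * m * J * z := by gcongr
      _ = (2 * k * m * J) * z * (n.choose 2 : ℝ) := by rw [hM]; ring
      _ ≤ _ := by gcongr; linarith

theorem mc_small (k N : ℕ) (hk : 2 ≤ k) (hN : N ≤ 2)
    (F : Set (Colouring k N)) (hF : F.Nonempty) (ε : ℝ) (hε : 0 < ε) (n : ℕ) (hn : 2 ≤ n) :
      ∃ T : Finset (Template k n),
        (∀ t ∈ T, Proper t) ∧
        IsContainerFamily T (Forb F n) ∧
        (∀ t ∈ T, (badPairs t F : ℝ) ≤ ε * (n.choose N : ℝ)) ∧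
        T.card ≤ 1 := by
  classical
  set E : Finset ((Fin N ↪o Fin n) × Colouring k N) := Finset.univ.filter (fun p => p.2 ∈ F)
    with hE
  have hE' : ∀ p, p ∈ E ↔ p.2 ∈ F := fun p => by simp [hE]
  rcases Nat.lt_or_ge N 2 with h | h
  · obtain ⟨T, a, b, d, e⟩ := mc_transfer F E hE' ∅ (ε * (n.choose N : ℝ)) (by simp) (by
      intro I hI
      exfalso
      obtain ⟨c, hc⟩ := hF
      refine hI (Fin.castLEOrderEmb (by omega), c) ((hE' _).2 hc) ?_
      have : mcEdge ((Fin.castLEOrderEmb (by omega : N ≤ n), c) :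
          (Fin N ↪o Fin n) × Colouring k N) = ∅ := by
        rw [← Finset.card_eq_zero, mc_card, Nat.choose_eq_zero_of_lt h]
      rw [this]; simp)
    exact ⟨T, a, b, d, e.trans (by simp)⟩
  · obtain rfl : N = 2 := by omega
    have hone : ∀ p : (Fin 2 ↪o Fin n) × Colouring k 2, ∃ u, mcEdge p = {u} := fun p => by
      rw [← Finset.card_eq_one, mc_card]; simp
    obtain ⟨T, a, b, d, e⟩ := mc_transfer F E hE'
      {Finset.univ.filter (fun u => ∀ p ∈ E, u ∉ mcEdge p)} (ε * (n.choose 2 : ℝ)) (by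
      intro C hC
      rw [Finset.mem_singleton] at hC
      subst hC
      rw [Finset.filter_false_of_mem]
      · simp; positivity
      · intro p hp hsub
        obtain ⟨u, hu⟩ := hone p
        have := hsub (hu ▸ Finset.mem_singleton_self u)
        simp only [Finset.mem_filter, Finset.mem_univ, true_and] at this
        exact this p hp (hu ▸ Finset.mem_singleton_self u)) (by
      intro I hI
      refine ⟨_, Finset.mem_singleton_self _, ?_⟩
      intro u hu
      simp only [Finset.mem_filter, Finset.mem_univ, true_and]
      intro p hp hup
      refine hI p hp ?_
      obtain ⟨w, hw⟩ := hone p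
      rw [hw] at hup ⊢
      rw [Finset.mem_singleton] at hup
      subst hup
      simpa using hu)
    exact ⟨T, a, b, d, e.trans (by simp)⟩

/-- Multicolour container theorem (Theorem 2.7 / `multi-colour container`). -/
theorem multicolour_containers (k N : ℕ) (hk : 2 ≤ k)
    (F : Set (Colouring k N)) (hF : F.Nonempty) (ε : ℝ) (hε : 0 < ε) :
    ∃ (C₀ : ℝ) (n₀ : ℕ), 0 < C₀ ∧ ∀ n, n₀ ≤ n →
      ∃ T : Finset (Template k n),
        (∀ t ∈ T, Proper t) ∧
        IsContainerFamily T (Forb F n) ∧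
        (∀ t ∈ T, (badPairs t F : ℝ) ≤ ε * (n.choose N : ℝ)) ∧
        Real.logb k (T.card : ℝ) ≤
          C₀ * (n : ℝ) ^ (-(1 / (2 * (N.choose 2 : ℝ) - 1))) * (n.choose 2 : ℝ) := by
  rcases Nat.lt_or_ge N 3 with hN | hN
  · refine ⟨1, 2, one_pos, fun n hn => ?_⟩
    obtain ⟨T, a, b, d, e⟩ := mc_small k N hk (by omega) F hF ε hε n hn
    refine ⟨T, a, b, d, ?_⟩
    have : Real.logb k (T.card : ℝ) = 0 := by
      have : T.card = 0 ∨ T.card = 1 := by omega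
      rcases this with h | h <;> rw [h] <;> simp
    rw [this]
    positivity
  · exact mc_big k N hk hN F hF ε hε
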